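/- Let y be a positive integer that is not a Zumkeller number. Then for all (x,z) ∈ ℕ×ℕ, the pair (x,z) belongs to Ulam[y] if and only if x+z is odd and culam[y](x,z) = 1. -/

import Mathlib

/-- Fuel-indexed Ulam predicate: a binary word (as a `List Bool`) of length 1 is Ulam,
and a longer word is Ulam iff it is expressible *uniquely* as a concatenation of two
distinct (nonempty) Ulam words. The fuel strictly exceeds the lengths needed. -/
def ulamAux : ℕ → List Bool → Prop
  | 0, _ => False
  | n + 1, w =>
    if w.length = 1 then True
    else ∃! p : List Bool × List Bool,
      p.1 ≠ [] ∧ p.2 ≠ [] ∧ p.1 ≠ p.2 ∧ w = p.1 ++ p.2 ∧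
        ulamAux n p.1 ∧ ulamAux n p.2

/-- A binary word is an Ulam word. -/
def IsUlam (w : List Bool) : Prop := ulamAux w.length w

/-- The word `0^x 1 0^y`. -/
def wordTwo (x y : ℕ) : List Bool :=
  List.replicate x false ++ [true] ++ List.replicate y false

/-- The word `0^x 1 0^y 1 0^z`. -/
def wordThree (x y z : ℕ) : List Bool :=
  List.replicate x false ++ [true] ++ List.replicate y false ++ [true] ++
    List.replicate z false

/-- `UlamSet y` is the set of pairs `(x,z)` such that `0^x 1 0^y 1 0^z` is Ulam. -/
def UlamSet (y : ℕ) : Set (ℕ × ℕ) := {p | IsUlam (wordThree p.1 y p.2)}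

/-- `culam y x z = min(2, N)` where `N` counts `0 ≤ a ≤ y` with both
`w(x,a)` and `w(y-a,z)` Ulam. -/
noncomputable def culam (y x z : ℕ) : ℕ :=
  min 2 {a : ℕ | a ≤ y ∧ IsUlam (wordTwo x a) ∧ IsUlam (wordTwo (y - a) z)}.ncard

/-- A positive integer is Zumkeller if its binary representation has at most one `0`. -/
def IsZumkeller (y : ℕ) : Prop := 0 < y ∧ (Nat.bits y).count false ≤ 1

/-- The largest `e ≤ d - 1` with `x mod 2^(e+1) < 2^e` and `z mod 2^(e+1) < 2^e`
(and `0` if none exists). -/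
def eIdx (d x z : ℕ) : ℕ :=
  Nat.findGreatest (fun e => x % 2 ^ (e + 1) < 2 ^ e ∧ z % 2 ^ (e + 1) < 2 ^ e) (d - 1)

/-- The universal pattern `E1[d]` on `B_d`. -/
def E1 (d x z : ℕ) : ℕ :=
  if 2 ^ d - 1 ≤ x + z then 0
  else if x % 2 ^ eIdx d x z + z % 2 ^ eIdx d x z < 2 ^ eIdx d x z - 1 then 2 else 1

/-- The universal pattern `E2[d]` on `B_d` (constant `1`). -/
def E2 (_d _x _z : ℕ) : ℕ := 1

/-- The universal pattern `O1[d]` on `B_d`. -/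
def O1 (d x z : ℕ) : ℕ :=
  if 2 ^ d - 2 ≤ x + z then 0
  else if (x + z) % 2 = 0 then (if x % 2 = 1 then 0 else 2)
  else if x % 2 ^ eIdx d x z + z % 2 ^ eIdx d x z < 2 ^ eIdx d x z - 1 then 2 else 1

/-- The universal pattern `O2[d]` on `B_d` (independent of `d`). -/
def O2 (_d x z : ℕ) : ℕ :=
  if (x + z) % 2 = 0 then (if x % 2 = 1 then 0 else 2) else 1

section Words

open Finset

theorem ulamAux_iff_isUlam (n : ℕ) (w : List Bool) (h : w.length ≤ n) :
    ulamAux n w ↔ IsUlam w := by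
  induction n using Nat.strong_induction_on generalizing w with
  | _ n ih =>
    unfold IsUlam
    rcases hl : w.length with _ | m
    · obtain rfl := List.length_eq_zero_iff.1 hl
      cases n with
      | zero => rfl
      | succ n =>
        simp only [ulamAux, List.length_nil, zero_ne_one, if_false, iff_false]
        rintro ⟨p, ⟨h1, _, _, h4, _⟩, _⟩
        exact h1 (List.append_eq_nil_iff.1 h4.symm).1
    · cases n with
      | zero => omega
      | succ n =>
        simp only [ulamAux]
        split_ifs with h1
        · rfl
        · refine existsUnique_congr fun p => ?_
          refine and_congr_right fun hp1 => and_congr_right fun hp2 =>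
            and_congr_right fun _ => and_congr_right fun hw => ?_
          have hlen : w.length = p.1.length + p.2.length := by rw [hw, List.length_append]
          have := List.length_pos_iff.2 hp1
          have := List.length_pos_iff.2 hp2
          rw [ih n (by omega) p.1 (by omega), ih n (by omega) p.2 (by omega),
            ih m (by omega) p.1 (by omega), ih m (by omega) p.2 (by omega)]

theorem isUlam_iff (w : List Bool) :
    IsUlam w ↔ w.length = 1 ∨ (w.length ≠ 1 ∧ ∃! p : List Bool × List Bool,
      p.1 ≠ [] ∧ p.2 ≠ [] ∧ p.1 ≠ p.2 ∧ w = p.1 ++ p.2 ∧ IsUlam p.1 ∧ IsUlam p.2) := by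
  rw [← ulamAux_iff_isUlam (w.length + 1) w (Nat.le_succ _)]
  simp only [ulamAux]
  split_ifs with h1
  · simp [h1]
  · simp only [h1, false_or, ne_eq, not_false_eq_true, true_and]
    refine existsUnique_congr fun p => and_congr_right fun _ => and_congr_right fun _ =>
      and_congr_right fun _ => and_congr_right fun hw => ?_
    have hlen : w.length = p.1.length + p.2.length := by rw [hw, List.length_append]
    rw [ulamAux_iff_isUlam _ p.1 (by omega), ulamAux_iff_isUlam _ p.2 (by omega)]

theorem not_isUlam_nil : ¬ IsUlam [] := by
  simp [IsUlam, ulamAux]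

/-- Nonemptiness of the factors is automatic, since Ulam words are nonempty. -/
theorem isUlam_iff_existsUnique {w : List Bool} (hw : w.length ≠ 1) :
    IsUlam w ↔ ∃! p : List Bool × List Bool,
      w = p.1 ++ p.2 ∧ p.1 ≠ p.2 ∧ IsUlam p.1 ∧ IsUlam p.2 := by
  rw [isUlam_iff]
  simp only [hw, false_or, ne_eq, not_false_eq_true, true_and]
  refine existsUnique_congr fun p => ⟨by tauto, fun ⟨h1, h2, h3, h4⟩ => ⟨?_, ?_, h2, h1, h3, h4⟩⟩
  · exact fun h => not_isUlam_nil (h ▸ h3)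
  · exact fun h => not_isUlam_nil (h ▸ h4)

theorem isUlam_replicate_false (n : ℕ) : IsUlam (List.replicate n false) ↔ n = 1 := by
  induction n using Nat.strong_induction_on with
  | _ n ih =>
    by_cases hn : n = 1
    · simp only [hn, iff_true]
      exact (isUlam_iff _).2 (Or.inl (by simp))
    · rw [isUlam_iff_existsUnique (by simpa using hn)]
      simp only [hn, iff_false]
      rintro ⟨⟨p, q⟩, ⟨h1, h2, h3, h4⟩, _⟩
      obtain ⟨hl, hp, hq⟩ := List.replicate_eq_append_iff.1 h1
      dsimp only at *
      have hp0 : p.length ≠ 0 := fun h => not_isUlam_nil (List.length_eq_zero_iff.1 h ▸ h3)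
      have hq0 : q.length ≠ 0 := fun h => not_isUlam_nil (List.length_eq_zero_iff.1 h ▸ h4)
      rw [hp] at h2 h3
      rw [hq] at h2 h4
      rw [ih _ (by omega)] at h3 h4
      rw [h3, h4] at h2
      exact h2 rfl

theorem replicate_append_true_eq_append_iff (x : ℕ) (t p q : List Bool) :
    List.replicate x false ++ true :: t = p ++ q ↔
      (∃ i j, i + j = x ∧ p = List.replicate i false ∧ q = List.replicate j false ++ true :: t) ∨
      ∃ s, p = List.replicate x false ++ true :: s ∧ t = s ++ q := by
  constructor
  · intro h
    rcases List.append_eq_append_iff.1 h with ⟨s, hp, hs⟩ | ⟨s, hs, hq⟩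
    · cases s with
      | nil => exact Or.inl ⟨x, 0, rfl, by simpa using hp, by simpa using hs.symm⟩
      | cons b s =>
        simp only [List.cons_append, List.cons.injEq] at hs
        obtain ⟨rfl, hs⟩ := hs
        exact Or.inr ⟨s, hp, hs⟩
    · obtain ⟨hl, hp, hs⟩ := List.replicate_eq_append_iff.1 hs
      exact Or.inl ⟨_, _, hl, hp, by rw [← hs, hq]⟩
  · rintro (⟨i, j, rfl, rfl, rfl⟩ | ⟨s, rfl, rfl⟩)
    · rw [← List.append_assoc, ← List.replicate_add]
    · simp

theorem wordTwo_eq (x y : ℕ) :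
    wordTwo x y = List.replicate x false ++ true :: List.replicate y false := by
  simp [wordTwo]

theorem wordThree_eq (x y z : ℕ) :
    wordThree x y z = List.replicate x false ++ true :: wordTwo y z := by
  simp [wordThree, wordTwo]

theorem count_true_wordTwo (x y : ℕ) : (wordTwo x y).count true = 1 := by
  simp [wordTwo, List.count_replicate]

theorem count_true_wordThree (x y z : ℕ) : (wordThree x y z).count true = 2 := by
  simp [wordThree, List.count_replicate]

theorem wordTwo_inj {x y x' y' : ℕ} : wordTwo x y = wordTwo x' y' ↔ x = x' ∧ y = y' := by
  refine ⟨fun h => ?_, by rintro ⟨rfl, rfl⟩; rfl⟩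
  have hl := congrArg List.length h
  have hx : x = x' := by
    have := congrArg (List.idxOf true) h
    simpa [wordTwo_eq, List.idxOf_append, List.mem_replicate] using this
  simp [wordTwo] at hl
  omega

theorem wordTwo_eq_append_iff (x y : ℕ) (p q : List Bool) :
    wordTwo x y = p ++ q ↔
      (∃ i j, i + j = x ∧ p = List.replicate i false ∧ q = wordTwo j y) ∨
      ∃ i j, i + j = y ∧ p = wordTwo x i ∧ q = List.replicate j false := by
  rw [wordTwo_eq, replicate_append_true_eq_append_iff]
  refine or_congr (by simp only [wordTwo_eq]) ⟨?_, ?_⟩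
  · rintro ⟨s, rfl, hs⟩
    obtain ⟨hl, hp, hq⟩ := List.replicate_eq_append_iff.1 hs
    exact ⟨_, _, hl, by rw [wordTwo_eq, ← hp], hq⟩
  · rintro ⟨i, j, rfl, rfl, rfl⟩
    exact ⟨_, wordTwo_eq _ _, List.replicate_add _ _ _⟩

theorem wordThree_eq_append_iff (x y z : ℕ) (p q : List Bool) :
    wordThree x y z = p ++ q ↔
      (∃ i j, i + j = x ∧ p = List.replicate i false ∧ q = wordThree j y z) ∨
      (∃ i j, i + j = y ∧ p = wordTwo x i ∧ q = wordTwo j z) ∨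
      ∃ i j, i + j = z ∧ p = wordThree x y i ∧ q = List.replicate j false := by
  rw [wordThree_eq, replicate_append_true_eq_append_iff]
  refine or_congr (by simp only [wordThree_eq]) ⟨?_, ?_⟩
  · rintro ⟨s, rfl, hs⟩
    rcases (wordTwo_eq_append_iff _ _ _ _).1 hs with ⟨i, j, hl, rfl, rfl⟩ | ⟨i, j, hl, rfl, rfl⟩
    · exact Or.inl ⟨i, j, hl, (wordTwo_eq _ _).symm, rfl⟩
    · exact Or.inr ⟨i, j, hl, (wordThree_eq _ _ _).symm, rfl⟩
  · rintro (⟨i, j, hl, rfl, rfl⟩ | ⟨i, j, hl, rfl, rfl⟩)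
    · exact ⟨_, wordTwo_eq _ _, (wordTwo_eq_append_iff _ _ _ _).2 (Or.inl ⟨i, j, hl, rfl, rfl⟩)⟩
    · exact ⟨_, wordThree_eq _ _ _,
        (wordTwo_eq_append_iff _ _ _ _).2 (Or.inr ⟨i, j, hl, rfl, rfl⟩)⟩

theorem existsUnique_or_or_iff_card {α β : Type*} {P Q : Prop} [Decidable P] [Decidable Q]
    {A B : β} (T : Finset α) (F : α → β) (hF : Function.Injective F) (hAB : A ≠ B) (hA : ∀ a, A ≠ F a)
    (hB : ∀ a, B ≠ F a) :
    (∃! p, (P ∧ p = A) ∨ (Q ∧ p = B) ∨ ∃ a ∈ T, p = F a) ↔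
      (if P then 1 else 0) + (if Q then 1 else 0) + #T = 1 := by
  classical
  let S : Finset β := (if P then {A} else ∅) ∪ (if Q then {B} else ∅) ∪ T.image F
  have hS : ∀ p, ((P ∧ p = A) ∨ (Q ∧ p = B) ∨ ∃ a ∈ T, p = F a) ↔ p ∈ S := by
    intro p
    simp only [S, mem_union, mem_image, or_assoc, @eq_comm _ p]
    refine or_congr ?_ (or_congr ?_ Iff.rfl)
    · split_ifs with h <;> simp [h, eq_comm]
    · split_ifs with h <;> simp [h, eq_comm]
  have hcard : #S = (if P then 1 else 0) + (if Q then 1 else 0) + #T := by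
    rw [card_union_of_disjoint, card_union_of_disjoint, card_image_of_injective _ hF]
    · split_ifs <;> simp
    · split_ifs <;> simp [hAB]
    · rw [disjoint_left]
      intro p hp hp'
      obtain ⟨a, _, rfl⟩ := mem_image.1 hp'
      rw [mem_union] at hp
      split_ifs at hp <;> simp [(hA a).symm, (hB a).symm] at hp
  simp only [hS]
  rw [← hcard, card_eq_one, ← singleton_iff_unique_mem]

end Words

section Disjoint

open Finset

theorem land_two_mul_two_mul (x a : ℕ) : 2 * x &&& 2 * a = 0 ↔ x &&& a = 0 := by
  have h1 := @Nat.and_div_two_pow (2 * x) (2 * a) 1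
  have h2 := @Nat.and_mod_two_pow (2 * x) (2 * a) 1
  simp at h1 h2
  omega

theorem land_two_mul_two_mul_add_one (x a : ℕ) : 2 * x &&& (2 * a + 1) = 0 ↔ x &&& a = 0 := by
  have h1 := @Nat.and_div_two_pow (2 * x) (2 * a + 1) 1
  have h2 := @Nat.and_mod_two_pow (2 * x) (2 * a + 1) 1
  have h3 : (2 * a + 1) / 2 = a := by omega
  simp [h3] at h1 h2
  omega

theorem land_two_mul_add_one_two_mul (x a : ℕ) : (2 * x + 1) &&& 2 * a = 0 ↔ x &&& a = 0 := by
  rw [Nat.land_comm, land_two_mul_two_mul_add_one, Nat.land_comm]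

theorem land_two_mul_add_one_two_mul_add_one (x a : ℕ) :
    (2 * x + 1) &&& (2 * a + 1) ≠ 0 := by
  have h2 := @Nat.and_mod_two_pow (2 * x + 1) (2 * a + 1) 1
  have h3 : (2 * a + 1) % 2 = 1 := by omega
  have h4 : (2 * x + 1) % 2 = 1 := by omega
  intro h
  rw [h, pow_one, h3, h4] at h2
  exact absurd h2 (by decide)

/-- Pascal's rule modulo two, as `(x + y).choose x` is odd iff `x &&& y = 0`. -/
theorem succ_land_succ_eq_zero_iff (x y : ℕ) :
    (x + 1) &&& (y + 1) = 0 ↔ ¬ (x &&& (y + 1) = 0 ↔ (x + 1) &&& y = 0) := by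
  induction x using Nat.strong_induction_on generalizing y with
  | _ x ih =>
    obtain ⟨m, rfl | rfl⟩ := Nat.even_or_odd' x <;> obtain ⟨n, rfl | rfl⟩ := Nat.even_or_odd' y
    · simp [land_two_mul_add_one_two_mul_add_one, land_two_mul_add_one_two_mul,
        land_two_mul_two_mul_add_one]
    · rw [show 2 * n + 1 + 1 = 2 * (n + 1) by ring]
      simp [land_two_mul_add_one_two_mul_add_one, land_two_mul_add_one_two_mul,
        land_two_mul_two_mul]
    · rw [show 2 * m + 1 + 1 = 2 * (m + 1) by ring]
      simp [land_two_mul_add_one_two_mul_add_one, land_two_mul_two_mul,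
        land_two_mul_two_mul_add_one]
    · rw [show 2 * m + 1 + 1 = 2 * (m + 1) by ring, show 2 * n + 1 + 1 = 2 * (n + 1) by ring,
        land_two_mul_two_mul, land_two_mul_add_one_two_mul, land_two_mul_two_mul_add_one]
      exact ih m (by omega) n

theorem isUlam_wordTwo (x y : ℕ) : IsUlam (wordTwo x y) ↔ x &&& y = 0 := by
  induction hn : x + y using Nat.strong_induction_on generalizing x y with
  | _ n ih =>
    subst hn
    by_cases h0 : x + y = 0
    · obtain ⟨rfl, rfl⟩ : x = 0 ∧ y = 0 := by omega
      simp only [Nat.and_zero, iff_true]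
      exact (isUlam_iff _).2 (Or.inl rfl)
    rw [isUlam_iff_existsUnique (by simp [wordTwo]; omega)]
    have key : ∀ p : List Bool × List Bool,
        (wordTwo x y = p.1 ++ p.2 ∧ p.1 ≠ p.2 ∧ IsUlam p.1 ∧ IsUlam p.2) ↔
        ((0 < x ∧ x - 1 &&& y = 0) ∧ p = ([false], wordTwo (x - 1) y)) ∨
        ((0 < y ∧ x &&& y - 1 = 0) ∧ p = (wordTwo x (y - 1), [false])) ∨
        ∃ a ∈ (∅ : Finset ℕ), p = (fun a => (List.replicate a true, [])) a := by
      rintro ⟨p, q⟩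
      simp only [wordTwo_eq_append_iff, notMem_empty, false_and, exists_false, or_false,
        Prod.mk.injEq]
      constructor
      · rintro ⟨⟨i, j, h, rfl, rfl⟩ | ⟨i, j, h, rfl, rfl⟩, _, h1, h2⟩
        · obtain rfl := (isUlam_replicate_false i).1 h1
          obtain rfl : j = x - 1 := by omega
          rw [ih _ (by omega) _ _ rfl] at h2
          exact Or.inl ⟨⟨by omega, h2⟩, rfl, rfl⟩
        · obtain rfl := (isUlam_replicate_false j).1 h2
          obtain rfl : i = y - 1 := by omega
          rw [ih _ (by omega) _ _ rfl] at h1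
          exact Or.inr ⟨⟨by omega, h1⟩, rfl, rfl⟩
      · rintro (⟨⟨h, h1⟩, rfl, rfl⟩ | ⟨⟨h, h1⟩, rfl, rfl⟩)
        · refine ⟨Or.inl ⟨1, x - 1, by omega, rfl, rfl⟩, fun he => ?_,
            (isUlam_replicate_false 1).2 rfl, (ih _ (by omega) _ _ rfl).2 h1⟩
          simpa [count_true_wordTwo] using congrArg (List.count true) he
        · refine ⟨Or.inr ⟨y - 1, 1, by omega, rfl, rfl⟩, fun he => ?_,
            (ih _ (by omega) _ _ rfl).2 h1, (isUlam_replicate_false 1).2 rfl⟩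
          simpa [count_true_wordTwo] using congrArg (List.count true) he
    rw [existsUnique_congr key, existsUnique_or_or_iff_card]
    · rcases x with _ | x <;> rcases y with _ | y
      · simp at h0
      · simp
      · simp
      · rw [succ_land_succ_eq_zero_iff]
        by_cases h1 : x &&& (y + 1) = 0 <;> by_cases h2 : (x + 1) &&& y = 0 <;> simp [h1, h2]
    · intro a b h
      simpa using h
    · intro h
      simpa [count_true_wordTwo] using congrArg (List.count true ∘ Prod.fst) h
    · intro a h
      simpa [wordTwo] using congrArg (List.length ∘ Prod.snd) h
    · intro a h
      simpa [wordTwo] using congrArg (List.length ∘ Prod.snd) h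

end Disjoint

section Count

open Finset

/-- The pairs `(a, b)` with `a + b = y` such that `w(x,a)` and `w(b,z)` are both Ulam. -/
def ulamSplits (x y z : ℕ) : Finset (ℕ × ℕ) :=
  {p ∈ antidiagonal y | x &&& p.1 = 0 ∧ p.2 &&& z = 0}

theorem mem_ulamSplits {x y z : ℕ} {p : ℕ × ℕ} :
    p ∈ ulamSplits x y z ↔ p.1 + p.2 = y ∧ x &&& p.1 = 0 ∧ p.2 &&& z = 0 := by
  simp [ulamSplits]

theorem culam_eq (x y z : ℕ) : culam y x z = min 2 #(ulamSplits x y z) := by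
  unfold culam
  congr 1
  rw [← Set.ncard_coe_finset, ← Set.InjOn.ncard_image (f := Prod.fst)]
  · congr 1
    ext a
    simp only [isUlam_wordTwo, Set.mem_ofPred_eq, Set.mem_image, mem_coe, mem_ulamSplits,
      Prod.exists, exists_and_right, exists_eq_right]
    constructor
    · rintro ⟨h1, h2, h3⟩
      exact ⟨y - a, by omega, h2, h3⟩
    · rintro ⟨b, rfl, h2, h3⟩
      exact ⟨by omega, h2, by simpa using h3⟩
  · rintro ⟨a, b⟩ h ⟨a', b'⟩ h' (rfl : a = a')
    simp only [mem_coe, mem_ulamSplits] at h h'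
    simp only [Prod.mk.injEq, true_and]
    omega

theorem sum_antidiagonal_two_mul_add_one (n : ℕ) (F : ℕ × ℕ → ℕ) :
    ∑ p ∈ antidiagonal (2 * n + 1), F p =
      ∑ p ∈ antidiagonal n, (F (2 * p.1, 2 * p.2 + 1) + F (2 * p.1 + 1, 2 * p.2)) := by
  induction n generalizing F with
  | zero => simp [Nat.antidiagonal_succ]
  | succ n ih =>
    rw [show 2 * (n + 1) + 1 = (2 * n + 1) + 1 + 1 by ring, Nat.sum_antidiagonal_succ,
      Nat.sum_antidiagonal_succ, ih (fun p => F (p.1 + 1 + 1, p.2)),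
      Nat.sum_antidiagonal_succ, ← add_assoc]
    rfl

theorem sum_antidiagonal_two_mul_add_two (n : ℕ) (F : ℕ × ℕ → ℕ) :
    ∑ p ∈ antidiagonal (2 * n + 2), F p =
      ∑ p ∈ antidiagonal (n + 1), F (2 * p.1, 2 * p.2) +
        ∑ p ∈ antidiagonal n, F (2 * p.1 + 1, 2 * p.2 + 1) := by
  rw [Nat.sum_antidiagonal_succ, sum_antidiagonal_two_mul_add_one, Nat.sum_antidiagonal_succ,
    sum_add_distrib, ← add_assoc, add_right_comm]
  rfl

theorem card_ulamSplits_eq_sum (x y z : ℕ) : #(ulamSplits x y z) =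
    ∑ p ∈ antidiagonal y, if x &&& p.1 = 0 ∧ p.2 &&& z = 0 then 1 else 0 :=
  card_filter _ _

theorem card_ulamSplits_pos_of_land_eq_zero {x z : ℕ} (h : x &&& z = 0) :
    0 < #(ulamSplits x (x + z) z) :=
  card_pos.2 ⟨(z, x), by simp [mem_ulamSplits, h, add_comm]⟩

theorem card_ulamSplits_zero_left_pos (y z : ℕ) : 0 < #(ulamSplits 0 y z) :=
  card_pos.2 ⟨(y, 0), by simp [mem_ulamSplits]⟩

theorem card_ulamSplits_zero_right_pos (x y : ℕ) : 0 < #(ulamSplits x y 0) :=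
  card_pos.2 ⟨(0, y), by simp [mem_ulamSplits]⟩

theorem card_ulamSplits_zero (x z : ℕ) : #(ulamSplits x 0 z) = 1 := by
  simp [-sum_boole, card_ulamSplits_eq_sum]

theorem card_ulamSplits_even_odd_even (x y z : ℕ) :
    #(ulamSplits (2 * x) (2 * y + 1) (2 * z)) = 2 * #(ulamSplits x y z) := by
  simp [-sum_boole, card_ulamSplits_eq_sum, sum_antidiagonal_two_mul_add_one, land_two_mul_two_mul,
    land_two_mul_two_mul_add_one, land_two_mul_add_one_two_mul, ← two_mul, mul_sum]

theorem card_ulamSplits_even_even_even (x y z : ℕ) :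
    #(ulamSplits (2 * x) (2 * (y + 1)) (2 * z)) =
      #(ulamSplits x (y + 1) z) + #(ulamSplits x y z) := by
  simp only [mul_add, mul_one, card_ulamSplits_eq_sum, sum_antidiagonal_two_mul_add_two,
    land_two_mul_two_mul, land_two_mul_two_mul_add_one, land_two_mul_add_one_two_mul]

theorem card_ulamSplits_odd_odd_even (x y z : ℕ) :
    #(ulamSplits (2 * x + 1) (2 * y + 1) (2 * z)) = #(ulamSplits x y z) := by
  simp [-sum_boole, card_ulamSplits_eq_sum, sum_antidiagonal_two_mul_add_one,
    land_two_mul_add_one_two_mul, land_two_mul_add_one_two_mul_add_one]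

theorem card_ulamSplits_even_odd_odd (x y z : ℕ) :
    #(ulamSplits (2 * x) (2 * y + 1) (2 * z + 1)) = #(ulamSplits x y z) := by
  simp [-sum_boole, card_ulamSplits_eq_sum, sum_antidiagonal_two_mul_add_one,
    land_two_mul_two_mul_add_one, land_two_mul_add_one_two_mul_add_one]

theorem card_ulamSplits_odd_odd_odd (x y z : ℕ) :
    #(ulamSplits (2 * x + 1) (2 * y + 1) (2 * z + 1)) = 0 := by
  simp [-sum_boole, card_ulamSplits_eq_sum, sum_antidiagonal_two_mul_add_one,
    land_two_mul_add_one_two_mul_add_one]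

theorem card_ulamSplits_odd_even_even (x y z : ℕ) :
    #(ulamSplits (2 * x + 1) (2 * y) (2 * z)) = #(ulamSplits x y z) := by
  cases y with
  | zero => simp [card_ulamSplits_zero]
  | succ y =>
    simp [-sum_boole, mul_add, card_ulamSplits_eq_sum, sum_antidiagonal_two_mul_add_two,
      land_two_mul_add_one_two_mul, land_two_mul_two_mul, land_two_mul_add_one_two_mul_add_one]

theorem card_ulamSplits_even_even_odd (x y z : ℕ) :
    #(ulamSplits (2 * x) (2 * y) (2 * z + 1)) = #(ulamSplits x y z) := by
  cases y with
  | zero => simp [card_ulamSplits_zero]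
  | succ y =>
    simp [-sum_boole, mul_add, card_ulamSplits_eq_sum, sum_antidiagonal_two_mul_add_two,
      land_two_mul_two_mul_add_one, land_two_mul_two_mul, land_two_mul_add_one_two_mul_add_one]

theorem card_ulamSplits_odd_even_odd (x y z : ℕ) :
    #(ulamSplits (2 * x + 1) (2 * y) (2 * z + 1)) = #(ulamSplits x y z) := by
  cases y with
  | zero => simp [card_ulamSplits_zero]
  | succ y =>
    simp [-sum_boole, mul_add, card_ulamSplits_eq_sum, sum_antidiagonal_two_mul_add_two,
      land_two_mul_two_mul_add_one, land_two_mul_add_one_two_mul,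
      land_two_mul_add_one_two_mul_add_one]

/-- If there is no splitting, then lowering any one of the three parameters by one gives the same
number of splittings. -/
theorem card_ulamSplits_pred_of_eq_zero (x y z : ℕ)
    (h : #(ulamSplits (x + 1) (y + 1) (z + 1)) = 0) :
    #(ulamSplits x (y + 1) (z + 1)) = #(ulamSplits (x + 1) y (z + 1)) ∧
      #(ulamSplits (x + 1) (y + 1) z) = #(ulamSplits (x + 1) y (z + 1)) := by
  induction y using Nat.strong_induction_on generalizing x z with
  | _ y ih =>
    obtain ⟨a, rfl | rfl⟩ := Nat.even_or_odd' x <;> obtain ⟨b, rfl | rfl⟩ := Nat.even_or_odd' y <;>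
      obtain ⟨c, rfl | rfl⟩ := Nat.even_or_odd' z <;>
      simp only [show ∀ n, 2 * n + 1 + 1 = 2 * (n + 1) from fun _ => rfl,
        card_ulamSplits_even_odd_even, card_ulamSplits_odd_odd_even, card_ulamSplits_even_odd_odd,
        card_ulamSplits_odd_odd_odd, card_ulamSplits_odd_even_even, card_ulamSplits_even_even_odd,
        card_ulamSplits_odd_even_odd, card_ulamSplits_even_even_even] at h ⊢
    · simp
    · omega
    · omega
    · cases a with
      | zero => exact absurd h (card_ulamSplits_zero_left_pos _ _).ne'
      | succ a =>
        have := ih b (by omega) a c h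
        omega
    · omega
    · cases b with
      | zero => simp [card_ulamSplits_zero] at h
      | succ b =>
        have := ih b (by omega) a c (by omega)
        rw [card_ulamSplits_even_even_even]
        omega
    · cases c with
      | zero => exact absurd h (card_ulamSplits_zero_right_pos _ _).ne'
      | succ c =>
        have := ih b (by omega) a c (by omega)
        omega
    · have := ih b (by omega) a c (by omega)
      omega

theorem card_ulamSplits_pred_eq_one (x y z : ℕ)
    (h : #(ulamSplits (x + 1) (y + 1) (z + 1)) = 1) (h0 : #(ulamSplits (x + 1) y (z + 1)) = 0) :
    #(ulamSplits x (y + 1) (z + 1)) = 1 ∨ #(ulamSplits (x + 1) (y + 1) z) = 1 := by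
  induction y using Nat.strong_induction_on generalizing x z with
  | _ y ih =>
    obtain ⟨a, rfl | rfl⟩ := Nat.even_or_odd' x <;> obtain ⟨b, rfl | rfl⟩ := Nat.even_or_odd' y <;>
      obtain ⟨c, rfl | rfl⟩ := Nat.even_or_odd' z <;>
      simp only [show ∀ n, 2 * n + 1 + 1 = 2 * (n + 1) from fun _ => rfl,
        card_ulamSplits_even_odd_even, card_ulamSplits_odd_odd_even, card_ulamSplits_even_odd_odd,
        card_ulamSplits_odd_odd_odd, card_ulamSplits_odd_even_even, card_ulamSplits_even_even_odd,
        card_ulamSplits_odd_even_odd, card_ulamSplits_even_even_even] at h h0 ⊢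
    all_goals try omega
    exact ih b (by omega) a c (by omega) (by omega)

theorem exists_pred_of_card_ulamSplits_eq_one {x y z : ℕ} (hxz : Even (x + z))
    (h : #(ulamSplits x (y + 1) z) = 1) :
    (∃ a, x = a + 1 ∧ #(ulamSplits a (y + 1) z) = 1) ∨
      ∃ c, z = c + 1 ∧ #(ulamSplits x (y + 1) c) = 1 := by
  obtain ⟨a, rfl | rfl⟩ := Nat.even_or_odd' x <;> obtain ⟨c, rfl | rfl⟩ := Nat.even_or_odd' z
  · obtain ⟨b, rfl | rfl⟩ := Nat.even_or_odd' y
    · rw [card_ulamSplits_even_odd_even] at h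
      omega
    · rw [show 2 * b + 1 + 1 = 2 * (b + 1) from rfl] at h ⊢
      rw [card_ulamSplits_even_even_even] at h
      rcases a with _ | a
      · have := card_ulamSplits_zero_left_pos (b + 1) c
        have := card_ulamSplits_zero_left_pos b c
        omega
      rcases c with _ | c
      · have := card_ulamSplits_zero_right_pos (a + 1) (b + 1)
        have := card_ulamSplits_zero_right_pos (a + 1) b
        omega
      have key : #(ulamSplits a (b + 1) (c + 1)) = 1 ∨ #(ulamSplits (a + 1) (b + 1) c) = 1 := by
        by_cases h0 : #(ulamSplits (a + 1) b (c + 1)) = 0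
        · exact card_ulamSplits_pred_eq_one a b c (by omega) h0
        · have := card_ulamSplits_pred_of_eq_zero a b c (by omega)
          omega
      refine key.imp (fun h => ⟨2 * a + 1, rfl, ?_⟩) (fun h => ⟨2 * c + 1, rfl, ?_⟩)
      · rwa [card_ulamSplits_odd_even_even]
      · rwa [card_ulamSplits_even_even_odd]
  · exact absurd hxz (by simp [parity_simps])
  · exact absurd hxz (by simp [parity_simps])
  · refine Or.inl ⟨2 * a, rfl, ?_⟩
    obtain ⟨b, rfl | rfl⟩ := Nat.even_or_odd' y
    · simp [card_ulamSplits_odd_odd_odd] at h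
    · rw [show 2 * b + 1 + 1 = 2 * (b + 1) from rfl, card_ulamSplits_odd_even_odd] at h
      rwa [show 2 * b + 1 + 1 = 2 * (b + 1) from rfl, card_ulamSplits_even_even_odd]

theorem card_ulamSplits_pos_of_add_eq_succ {x y z : ℕ} (hd : x &&& z = 0) (h : x + z = y + 1) :
    0 < #(ulamSplits x y z) := by
  induction y using Nat.strong_induction_on generalizing x z with
  | _ y ih =>
    obtain ⟨a, rfl | rfl⟩ := Nat.even_or_odd' x <;> obtain ⟨c, rfl | rfl⟩ := Nat.even_or_odd' z
    · obtain ⟨b, rfl⟩ : ∃ b, y = 2 * b + 1 := ⟨a + c - 1, by omega⟩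
      have := ih b (by omega) ((land_two_mul_two_mul _ _).1 hd) (by omega)
      rw [card_ulamSplits_even_odd_even]
      omega
    · obtain rfl : y = 2 * (a + c) := by omega
      rw [card_ulamSplits_even_even_odd]
      exact card_ulamSplits_pos_of_land_eq_zero ((land_two_mul_two_mul_add_one _ _).1 hd)
    · obtain rfl : y = 2 * (a + c) := by omega
      rw [card_ulamSplits_odd_even_even]
      exact card_ulamSplits_pos_of_land_eq_zero ((land_two_mul_add_one_two_mul _ _).1 hd)
    · exact absurd hd (land_two_mul_add_one_two_mul_add_one _ _)

theorem count_false_bits_lt_card_ulamSplits {x y z : ℕ} (hd : x &&& z = 0) (h : x + z = y) :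
    y.bits.count false < #(ulamSplits x y z) := by
  induction y using Nat.strong_induction_on generalizing x z with
  | _ y ih =>
    have hodd : ∀ n, (2 * n + 1).bits.count false = n.bits.count false := fun n => by
      rw [Nat.bit1_bits, List.count_cons_of_ne (by simp)]
    obtain ⟨a, rfl | rfl⟩ := Nat.even_or_odd' x <;> obtain ⟨c, rfl | rfl⟩ := Nat.even_or_odd' z
    · rcases hb : a + c with _ | b
      · obtain rfl : y = 0 := by omega
        simp [card_ulamSplits_zero]
      · obtain rfl : y = 2 * (b + 1) := by omega
        rw [land_two_mul_two_mul] at hd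
        have := ih (b + 1) (by omega) hd hb
        have := card_ulamSplits_pos_of_add_eq_succ hd hb
        rw [card_ulamSplits_even_even_even, Nat.bit0_bits _ (by omega), List.count_cons_self]
        omega
    · obtain rfl : y = 2 * (a + c) + 1 := by omega
      rw [hodd, card_ulamSplits_even_odd_odd]
      exact ih _ (by omega) ((land_two_mul_two_mul_add_one _ _).1 hd) rfl
    · obtain rfl : y = 2 * (a + c) + 1 := by omega
      rw [hodd, card_ulamSplits_odd_odd_even]
      exact ih _ (by omega) ((land_two_mul_add_one_two_mul _ _).1 hd) rfl
    · exact absurd hd (land_two_mul_add_one_two_mul_add_one _ _)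

end Count

section Main

open Finset

open Classical in
theorem isUlam_wordThree_iff (x y z : ℕ) :
    IsUlam (wordThree x y z) ↔
      (if 0 < x ∧ IsUlam (wordThree (x - 1) y z) then 1 else 0) +
        (if 0 < z ∧ IsUlam (wordThree x y (z - 1)) then 1 else 0) +
        #((ulamSplits x y z).erase (z, x)) = 1 := by
  rw [isUlam_iff_existsUnique (by simp [wordThree]; omega)]
  have key : ∀ p : List Bool × List Bool,
      (wordThree x y z = p.1 ++ p.2 ∧ p.1 ≠ p.2 ∧ IsUlam p.1 ∧ IsUlam p.2) ↔
      ((0 < x ∧ IsUlam (wordThree (x - 1) y z)) ∧ p = ([false], wordThree (x - 1) y z)) ∨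
      ((0 < z ∧ IsUlam (wordThree x y (z - 1))) ∧ p = (wordThree x y (z - 1), [false])) ∨
      ∃ a ∈ (ulamSplits x y z).erase (z, x),
        p = (fun a : ℕ × ℕ => (wordTwo x a.1, wordTwo a.2 z)) a := by
    rintro ⟨p, q⟩
    simp only [wordThree_eq_append_iff, mem_erase, mem_ulamSplits, Prod.mk.injEq, Prod.exists]
    constructor
    · rintro ⟨⟨i, j, h, rfl, rfl⟩ | ⟨i, j, h, rfl, rfl⟩ | ⟨i, j, h, rfl, rfl⟩, hne, h1, h2⟩
      · obtain rfl := (isUlam_replicate_false i).1 h1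
        obtain rfl : j = x - 1 := by omega
        exact Or.inl ⟨⟨by omega, h2⟩, rfl, rfl⟩
      · rw [isUlam_wordTwo] at h1 h2
        refine Or.inr (Or.inr ⟨i, j, ⟨?_, h, h1, h2⟩, rfl, rfl⟩)
        rintro ⟨rfl, rfl⟩
        exact hne rfl
      · obtain rfl := (isUlam_replicate_false j).1 h2
        obtain rfl : i = z - 1 := by omega
        exact Or.inr (Or.inl ⟨⟨by omega, h1⟩, rfl, rfl⟩)
    · rintro (⟨⟨h, h1⟩, rfl, rfl⟩ | ⟨⟨h, h1⟩, rfl, rfl⟩ | ⟨i, j, ⟨hne, h, h1, h2⟩, rfl, rfl⟩)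
      · refine ⟨Or.inl ⟨1, x - 1, by omega, rfl, rfl⟩, fun he => ?_,
          (isUlam_replicate_false 1).2 rfl, h1⟩
        simpa [count_true_wordThree] using congrArg (List.count true) he
      · refine ⟨Or.inr (Or.inr ⟨z - 1, 1, by omega, rfl, rfl⟩), fun he => ?_,
          h1, (isUlam_replicate_false 1).2 rfl⟩
        simpa [count_true_wordThree] using congrArg (List.count true) he
      · refine ⟨Or.inr (Or.inl ⟨i, j, h, rfl, rfl⟩), fun he => ?_,
          (isUlam_wordTwo _ _).2 h1, (isUlam_wordTwo _ _).2 h2⟩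
        rw [wordTwo_inj] at he
        exact hne (Prod.ext he.2 he.1.symm)
  rw [existsUnique_congr key, existsUnique_or_or_iff_card]
  · rintro ⟨a, b⟩ ⟨a', b'⟩ h
    simp only [Prod.mk.injEq, wordTwo_inj, true_and, and_true] at h
    exact Prod.ext h.1 h.2
  · intro h
    simpa [count_true_wordThree] using congrArg (List.count true ∘ Prod.fst) h
  · intro a h
    simpa [count_true_wordTwo] using congrArg (List.count true ∘ Prod.fst) h
  · intro a h
    simpa [count_true_wordTwo] using congrArg (List.count true ∘ Prod.snd) h

theorem card_erase_ulamSplits {x y z : ℕ} (hy : 2 ≤ y.bits.count false) :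
    #((ulamSplits x y z).erase (z, x)) = #(ulamSplits x y z) ∨
      2 ≤ #((ulamSplits x y z).erase (z, x)) ∧ 2 ≤ #(ulamSplits x y z) := by
  by_cases h : (z, x) ∈ ulamSplits x y z
  · rw [card_erase_of_mem h]
    obtain ⟨h1, h2, -⟩ := mem_ulamSplits.1 h
    have : y.bits.count false < #(ulamSplits x y z) :=
      count_false_bits_lt_card_ulamSplits h2 ((add_comm x z).trans h1)
    omega
  · rw [erase_eq_of_notMem h]
    exact Or.inl rfl

theorem isUlam_wordThree_iff_of_two_le_count {y : ℕ} (hy : 0 < y) (hb : 2 ≤ y.bits.count false)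
    (x z : ℕ) : IsUlam (wordThree x y z) ↔ Odd (x + z) ∧ #(ulamSplits x y z) = 1 := by
  induction hn : x + z using Nat.strong_induction_on generalizing x z with
  | _ n ih =>
    subst hn
    obtain ⟨y, rfl⟩ := Nat.exists_eq_add_of_lt hy
    rw [zero_add] at *
    have hx : (0 < x ∧ IsUlam (wordThree (x - 1) (y + 1) z)) ↔
        Even (x + z) ∧ ∃ a, x = a + 1 ∧ #(ulamSplits a (y + 1) z) = 1 := by
      cases x with
      | zero => simp
      | succ a =>
        have : Odd (a + z) ↔ Even (a + 1 + z) := by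
          rw [add_right_comm, Nat.even_add_one, Nat.not_even_iff_odd]
        simp [ih (a + z) (by omega) a z rfl, this]
    have hz : (0 < z ∧ IsUlam (wordThree x (y + 1) (z - 1))) ↔
        Even (x + z) ∧ ∃ c, z = c + 1 ∧ #(ulamSplits x (y + 1) c) = 1 := by
      cases z with
      | zero => simp
      | succ c =>
        have : Odd (x + c) ↔ Even (x + (c + 1)) := by
          rw [← add_assoc, Nat.even_add_one, Nat.not_even_iff_odd]
        simp [ih (x + c) (by omega) x c rfl, this]
    classical
    rw [isUlam_wordThree_iff, if_congr hx rfl rfl, if_congr hz rfl rfl]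
    have he := card_erase_ulamSplits (x := x) (z := z) hb
    rcases Nat.even_or_odd (x + z) with hxz | hxz
    · simp only [hxz, true_and, ← Nat.not_even_iff_odd, not_true, false_and, iff_false]
      intro h
      by_cases h1 : #(ulamSplits x (y + 1) z) = 1
      · have := exists_pred_of_card_ulamSplits_eq_one hxz h1
        rcases this with h2 | h2 <;> simp only [h2, if_true] at h <;> omega
      · have h0 : #(ulamSplits x (y + 1) z) = 0 := by
          split_ifs at h <;> omega
        rcases x with _ | a
        · exact (card_ulamSplits_zero_left_pos _ _).ne' h0
        rcases z with _ | c
        · exact (card_ulamSplits_zero_right_pos _ _).ne' h0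
        obtain ⟨h2, h3⟩ := card_ulamSplits_pred_of_eq_zero a y c h0
        simp only [Nat.add_right_cancel_iff, exists_eq_left', h2, h3] at h
        split_ifs at h <;> omega
    · simp only [hxz, ← Nat.not_odd_iff_even, not_true, false_and, if_false, true_and]
      omega

end Main

/-- For positive non-Zumkeller `y`, `(x,z) ∈ Ulam[y]` iff `x+z` is odd
and `culam[y](x,z) = 1`. -/
theorem ulamSet_eq_of_not_zumkeller (y : ℕ) (hy : 0 < y) (hzum : ¬ IsZumkeller y)
    (x z : ℕ) :
    (x, z) ∈ UlamSet y ↔ (x + z) % 2 = 1 ∧ culam y x z = 1 := by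
  have hb : 2 ≤ y.bits.count false := by
    by_contra h
    exact hzum ⟨hy, by omega⟩
  rw [culam_eq, ← Nat.odd_iff]
  refine (isUlam_wordThree_iff_of_two_le_count hy hb x z).trans (and_congr_right fun _ => ?_)
  omega
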